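/- Let s ∈ M_m be maximal. Then d_t(s) ≤ ρ(s) ≤ 2·d_{t+1}(s) − 1. -/

import Mathlib

open Polynomial

/-- `Φ(s)`: the number of distinct monic divisors of `s` in `F[x]`. -/
noncomputable def numDiv {F : Type} [Field F] (s : F[X]) : ℕ :=
  Set.ncard {d : F[X] | d.Monic ∧ d ∣ s}

/-- `s` is maximal in `M_m`: `s` is monic of degree exactly `m` and `Φ(s) = Υ_m`. -/
def IsMaximal {F : Type} [Field F] (m : ℕ) (s : F[X]) : Prop :=
  s.Monic ∧ s.natDegree = m ∧
    ∀ t : F[X], t.Monic → t.natDegree ≤ m → numDiv t ≤ numDiv s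

/-- `ρ(s)`: the maximum multiplicity in `s` of a monic polynomial of degree 1. -/
noncomputable def rho {F : Type} [Field F] (s : F[X]) : ℕ :=
  sSup {r : ℕ | ∃ p : F[X], p.Monic ∧ p.natDegree = 1 ∧ r = multiplicity p s}

/-- `d_t(s)`: the largest degree of a monic irreducible factor of `s`. -/
noncomputable def dt {F : Type} [Field F] (s : F[X]) : ℕ :=
  sSup {d : ℕ | ∃ p : F[X], p.Monic ∧ Irreducible p ∧ p ∣ s ∧ p.natDegree = d}

/-- `d_{t+1}(s)`: the smallest positive integer `d` such that some monic irreducible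
polynomial of degree `d` does not divide `s`. -/
noncomputable def dt1 {F : Type} [Field F] (s : F[X]) : ℕ :=
  sInf {d : ℕ | 0 < d ∧ ∃ p : F[X], p.Monic ∧ Irreducible p ∧ p.natDegree = d ∧ ¬ p ∣ s}

/-- If `p` is irreducible and does not divide `u`, then `Φ(p ^ a * u) = (a + 1) * Φ(u)`. -/
theorem numDiv_pow_mul {F : Type} [Field F] {p u : F[X]} (hpm : p.Monic) (hp : Irreducible p)
    (hpu : ¬ p ∣ u) (a : ℕ) : numDiv (p ^ a * u) = (a + 1) * numDiv u := by
  have hp0 : p ≠ 0 := hp.ne_zero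
  have himage : {d : F[X] | d.Monic ∧ d ∣ p ^ a * u} =
      (fun x : ℕ × F[X] => p ^ x.1 * x.2) '' (Set.Iio (a + 1) ×ˢ {d : F[X] | d.Monic ∧ d ∣ u}) := by
    ext d
    constructor
    · rintro ⟨hdm, hd⟩
      obtain ⟨e, hde, hpe⟩ :=
        (FiniteMultiplicity.of_not_isUnit hp.not_isUnit hdm.ne_zero).exists_eq_pow_mul_and_not_dvd
      set k := multiplicity p d
      have hem : e.Monic := (hpm.pow k).of_mul_monic_left (hde ▸ hdm)
      have hk : k ≤ a := by
        have hdvd : p ^ k ∣ p ^ a * u := (Dvd.intro _ hde.symm).trans hd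
        by_contra! h
        have hj : p ^ a * p ∣ p ^ a * u := by
          rw [← pow_succ]
          exact (pow_dvd_pow p h).trans hdvd
        exact hpu ((mul_dvd_mul_iff_left (pow_ne_zero a hp0)).1 hj)
      have hcop : IsCoprime e (p ^ a) := ((hp.coprime_iff_not_dvd.2 hpe).symm).pow_right
      exact ⟨(k, e), ⟨Nat.lt_succ_of_le hk, hem,
        hcop.dvd_of_dvd_mul_left ((Dvd.intro_left _ hde.symm).trans hd)⟩, hde.symm⟩
    · rintro ⟨⟨k, e⟩, ⟨hk, hem, he⟩, rfl⟩
      exact ⟨(hpm.pow k).mul hem, mul_dvd_mul (pow_dvd_pow p (Nat.lt_succ_iff.1 hk)) he⟩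
  have hinj : Set.InjOn (fun x : ℕ × F[X] => p ^ x.1 * x.2)
      (Set.Iio (a + 1) ×ˢ {d : F[X] | d.Monic ∧ d ∣ u}) := by
    rintro ⟨i, d⟩ ⟨-, -, hd⟩ ⟨j, e⟩ ⟨-, -, he⟩ h
    have key : ∀ (i j : ℕ) (d e : F[X]), d ∣ u → p ^ i * d = p ^ j * e → j ≤ i := by
      intro i j d e hd h
      by_contra! hij
      have hdvd : p ^ i * p ∣ p ^ i * d := by
        rw [h, ← pow_succ]
        exact (pow_dvd_pow p hij).mul_right e
      exact hpu (((mul_dvd_mul_iff_left (pow_ne_zero i hp0)).1 hdvd).trans hd)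
    dsimp only at h
    obtain rfl : i = j := le_antisymm (key j i e d he h.symm) (key i j d e hd h)
    rw [mul_left_cancel₀ (pow_ne_zero i hp0) h]
  rw [numDiv, himage, hinj.ncard_image, Set.ncard_prod, numDiv]
  congr 1
  rw [Set.ncard_eq_toFinset_card']
  simp

theorem numDiv_one {F : Type} [Field F] : numDiv (1 : F[X]) = 1 := by
  rw [numDiv, Set.ncard_eq_one]
  refine ⟨1, Set.ext fun d => ⟨fun h => ?_, ?_⟩⟩
  · exact h.1.isUnit_iff.1 (isUnit_of_dvd_one h.2)
  · rintro rfl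
    exact ⟨monic_one, dvd_rfl⟩

theorem IsMaximal.numDiv_pos {F : Type} [Field F] {m : ℕ} {s : F[X]} (hs : IsMaximal m s) :
    0 < numDiv s := by
  have h := hs.2.2 1 monic_one (by simp)
  rw [numDiv_one] at h
  exact h

theorem exists_eq_pow_mul_monic {F : Type} [Field F] {p s : F[X]} (hpm : p.Monic)
    (hp : Irreducible p) (hs : s.Monic) :
    ∃ u : F[X], u.Monic ∧ ¬ p ∣ u ∧ s = p ^ multiplicity p s * u := by
  obtain ⟨u, h, hpu⟩ :=
    (FiniteMultiplicity.of_not_isUnit hp.not_isUnit hs.ne_zero).exists_eq_pow_mul_and_not_dvd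
  exact ⟨u, (hpm.pow _).of_mul_monic_left (h ▸ hs), hpu, h⟩

theorem multiplicity_le_rho {F : Type} [Field F] {p s : F[X]} (hpm : p.Monic)
    (hp : p.natDegree = 1) (hs : s.Monic) : multiplicity p s ≤ rho s := by
  refine le_csSup ⟨s.natDegree, ?_⟩ ⟨p, hpm, hp, rfl⟩
  rintro r ⟨l, -, hl, rfl⟩
  have h := natDegree_le_of_dvd (pow_multiplicity_dvd l s) hs.ne_zero
  rwa [natDegree_pow, hl, mul_one] at h

theorem not_dvd_of_monic_irreducible_of_ne {F : Type} [Field F] {p l : F[X]} (hpm : p.Monic)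
    (hlm : l.Monic) (hp : Irreducible p) (hl : Irreducible l) (hne : p ≠ l) : ¬ p ∣ l :=
  fun h => hne (eq_of_monic_of_associated hpm hlm (hp.associated_of_dvd hl h))

theorem mul_add_two_lt_mul_add_one_of_le {r₁ r₂ c e : ℕ} (h₁ : r₁ ≤ e + 1) (h₂ : r₂ ≤ e + 1) :
    (r₁ + 1) * (r₂ + 1) * (c + 2) < (r₁ + 2) * (r₂ + e + 2) * (c + 1) := by
  have h : 2 * ((r₁ + 1) * (r₂ + 1)) < (r₁ + 2) * (r₂ + e + 2) := by
    nlinarith [Nat.mul_le_mul h₁ h₂, Nat.mul_le_mul_left r₁ h₂]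
  have hc : (r₁ + 1) * (r₂ + 1) * (c + 2) ≤ 2 * ((r₁ + 1) * (r₂ + 1)) * (c + 1) := by
    rw [mul_comm 2, mul_assoc _ 2]
    exact Nat.mul_le_mul_left _ (by omega)
  exact hc.trans_lt (Nat.mul_lt_mul_of_pos_right h c.succ_pos)

/-- Trading one factor `p` of `s` for one factor `X` and `deg p - 1` factors `X - 1` keeps the degree
and increases the number of divisors when all linear multiplicities are below `deg p`. -/
theorem natDegree_le_rho {F : Type} [Field F] {m : ℕ} {s p : F[X]} (hs : IsMaximal m s)
    (hpm : p.Monic) (hp : Irreducible p) (hps : p ∣ s) : p.natDegree ≤ rho s := by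
  have hsm := hs.1
  obtain hd | hd : p.natDegree = 1 ∨ 2 ≤ p.natDegree := by
    have := hp.natDegree_pos
    omega
  · rw [hd]
    refine le_trans ?_ (multiplicity_le_rho hpm hd hsm)
    exact (FiniteMultiplicity.of_not_isUnit hp.not_isUnit hsm.ne_zero).le_multiplicity_of_pow_dvd
      (by rwa [pow_one])
  by_contra! hlt
  have hXm : (X : F[X]).Monic := monic_X
  have hYm : (X - C 1 : F[X]).Monic := monic_X_sub_C 1
  have hX : Irreducible (X : F[X]) := irreducible_X
  have hY : Irreducible (X - C 1 : F[X]) := irreducible_X_sub_C 1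
  have hr₁ := multiplicity_le_rho hXm natDegree_X hsm
  have hpX : ¬ p ∣ X := not_dvd_of_monic_irreducible_of_ne hpm hXm hp hX (by
    rintro rfl
    simp at hd)
  have hpY : ¬ p ∣ X - C 1 := not_dvd_of_monic_irreducible_of_ne hpm hYm hp hY (by
    rintro rfl
    rw [natDegree_X_sub_C] at hd
    omega)
  have hXY : ¬ (X : F[X]) ∣ X - C 1 := by
    rw [X_dvd_iff]
    simp
  obtain ⟨u, hum, hXu, hsu⟩ := exists_eq_pow_mul_monic hXm hX hsm
  obtain ⟨v, hvm, hYv, huv⟩ := exists_eq_pow_mul_monic hYm hY hum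
  obtain ⟨w, hwm, hpw, hvw⟩ := exists_eq_pow_mul_monic hpm hp hvm
  have hr₂ : multiplicity (X - C 1) u ≤ multiplicity (X - C 1) s :=
    (FiniteMultiplicity.of_not_isUnit hY.not_isUnit hsm.ne_zero).le_multiplicity_of_pow_dvd
      ((pow_multiplicity_dvd _ _).trans (Dvd.intro_left _ hsu.symm))
  have hr₂' := hr₂.trans (multiplicity_le_rho hYm (natDegree_X_sub_C 1) hsm)
  generalize multiplicity X s = r₁ at *
  generalize multiplicity (X - C 1) u = r₂ at *
  generalize multiplicity p v = b at *
  have hpos_b : b ≠ 0 := by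
    rintro rfl
    rw [hvw, pow_zero, one_mul] at huv
    rw [hsu, huv] at hps
    exact (hp.prime.dvd_or_dvd hps).elim (fun h => hpX (hp.prime.dvd_of_dvd_pow h))
      fun h => (hp.prime.dvd_or_dvd h).elim (fun h => hpY (hp.prime.dvd_of_dvd_pow h)) hpw
  obtain ⟨c, rfl⟩ := Nat.exists_eq_succ_of_ne_zero hpos_b
  have hXw : ¬ X ∣ w := fun h => hXu (huv ▸ (hvw ▸ h.mul_left _ : X ∣ v).mul_left _)
  have hYw : ¬ X - C 1 ∣ w := fun h => hYv (hvw ▸ h.mul_left _)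
  have hXp : ¬ X ∣ p := not_dvd_of_monic_irreducible_of_ne hXm hpm hX hp (by
    rintro rfl
    simp at hd)
  have hYp : ¬ X - C 1 ∣ p := not_dvd_of_monic_irreducible_of_ne hYm hpm hY hp (by
    rintro rfl
    rw [natDegree_X_sub_C] at hd
    omega)
  have hnumDiv : ∀ i j k : ℕ, numDiv (X ^ i * ((X - C 1) ^ j * (p ^ k * w))) =
      (i + 1) * ((j + 1) * ((k + 1) * numDiv w)) := by
    intro i j k
    have hYpw : ¬ X - C 1 ∣ p ^ k * w := fun h =>
      (hY.prime.dvd_or_dvd h).elim (fun h => hYp (hY.prime.dvd_of_dvd_pow h)) hYw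
    have hXYpw : ¬ X ∣ (X - C 1) ^ j * (p ^ k * w) := fun h =>
      (hX.prime.dvd_or_dvd h).elim (fun h => hXY (hX.prime.dvd_of_dvd_pow h)) fun h =>
        (hX.prime.dvd_or_dvd h).elim (fun h => hXp (hX.prime.dvd_of_dvd_pow h)) hXw
    rw [numDiv_pow_mul hXm hX hXYpw, numDiv_pow_mul hYm hY hYpw, numDiv_pow_mul hpm hp hpw]
  have hmonic : ∀ i j k : ℕ, (X ^ i * ((X - C 1) ^ j * (p ^ k * w))).Monic := fun i j k =>
    (hXm.pow i).mul ((hYm.pow j).mul ((hpm.pow k).mul hwm))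
  have hdegree : ∀ i j k : ℕ, (X ^ i * ((X - C 1) ^ j * (p ^ k * w))).natDegree =
      i + (j + (k * p.natDegree + w.natDegree)) := fun i j k => by
    rw [(hXm.pow i).natDegree_mul ((hYm.pow j).mul ((hpm.pow k).mul hwm)),
      (hYm.pow j).natDegree_mul ((hpm.pow k).mul hwm), (hpm.pow k).natDegree_mul hwm,
      hXm.natDegree_pow, hYm.natDegree_pow, hpm.natDegree_pow, natDegree_X, natDegree_X_sub_C,
      mul_one, mul_one]
  have hs_eq : s = X ^ r₁ * ((X - C 1) ^ r₂ * (p ^ (c + 1) * w)) := by rw [hsu, huv, hvw]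
  obtain ⟨e, he⟩ := Nat.exists_eq_add_of_le hd
  have hle := hs.2.2 _ (hmonic (r₁ + 1) (r₂ + (e + 1)) c) (by
    rw [← hs.2.1, hs_eq, hdegree, hdegree, add_mul c 1, one_mul]
    omega)
  have hpos := hs.numDiv_pos
  rw [hs_eq, hnumDiv] at hle hpos
  rw [hnumDiv] at hle
  have hwpos : 0 < numDiv w :=
    Nat.pos_of_mul_pos_left (Nat.pos_of_mul_pos_left (Nat.pos_of_mul_pos_left hpos))
  have hlt' := mul_add_two_lt_mul_add_one_of_le
    (r₁ := r₁) (r₂ := r₂) (c := c) (e := e) (by omega) (by omega)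
  refine absurd hle (not_le.2 ?_)
  calc _ = ((r₁ + 1) * (r₂ + 1) * (c + 2)) * numDiv w := by ring
    _ < ((r₁ + 2) * (r₂ + e + 2) * (c + 1)) * numDiv w := Nat.mul_lt_mul_of_pos_right hlt' hwpos
    _ = _ := by ring

/-- Trading `deg p` copies of a linear factor `l` for one copy of `p ∤ s` keeps the degree and
increases the number of divisors when `l` has multiplicity at least `2 * deg p`. -/
theorem rho_le {F : Type} [Field F] {m : ℕ} {s p : F[X]} (hs : IsMaximal m s)
    (hpm : p.Monic) (hp : Irreducible p) (hps : ¬ p ∣ s) : rho s ≤ 2 * p.natDegree - 1 := by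
  refine csSup_le' ?_
  rintro r ⟨l, hlm, hl1, rfl⟩
  have hsm := hs.1
  have hd := hp.natDegree_pos
  have hl : Irreducible l := irreducible_of_degree_eq_one
    (degree_eq_iff_natDegree_eq_of_pos one_pos |>.2 hl1)
  obtain ⟨u, hum, hlu, hsu⟩ := exists_eq_pow_mul_monic hlm hl hsm
  generalize multiplicity l s = r at *
  by_contra! hr
  have hls : l ∣ s := hsu ▸ (dvd_pow_self l (by omega)).mul_right u
  have hpu : ¬ p ∣ u := fun h => hps (hsu ▸ h.mul_left _)
  have hlp : ¬ l ∣ p := not_dvd_of_monic_irreducible_of_ne hlm hpm hl hp (by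
    rintro rfl
    exact hps hls)
  obtain ⟨k, rfl⟩ := Nat.exists_eq_add_of_le (show 2 * p.natDegree ≤ r by omega)
  have htm : (l ^ (p.natDegree + k) * (p ^ 1 * u)).Monic := (hlm.pow _).mul ((hpm.pow 1).mul hum)
  have hle := hs.2.2 _ htm (by
    rw [← hs.2.1, hsu, (hlm.pow _).natDegree_mul ((hpm.pow 1).mul hum),
      (hpm.pow 1).natDegree_mul hum, (hlm.pow _).natDegree_mul hum, hlm.natDegree_pow,
      hlm.natDegree_pow, hpm.natDegree_pow, hl1]
    omega)
  have hlpu : ¬ l ∣ p ^ 1 * u := by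
    rw [pow_one]
    exact fun h => (hl.prime.dvd_or_dvd h).elim hlp hlu
  have hpos := hs.numDiv_pos
  rw [hsu, numDiv_pow_mul hlm hl hlu] at hle hpos
  rw [numDiv_pow_mul hlm hl hlpu, numDiv_pow_mul hpm hp hpu] at hle
  have hupos : 0 < numDiv u := Nat.pos_of_mul_pos_left hpos
  nlinarith

theorem exists_monic_irreducible_not_dvd {F : Type} [Field F] {s : F[X]} (hs : s.Monic) :
    ∃ p : F[X], p.Monic ∧ Irreducible p ∧ ¬ p ∣ s := by
  have hdeg : (s * X + 1).natDegree = s.natDegree + 1 := by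
    rw [← C_1, natDegree_add_C, natDegree_mul_X hs.ne_zero]
  obtain ⟨p, hpm, hp, hdvd⟩ := exists_monic_irreducible_factor (s * X + 1) (fun h => by
    have := natDegree_eq_zero_of_isUnit h
    omega)
  exact ⟨p, hpm, hp, fun h =>
    hp.not_isUnit (isUnit_of_dvd_one ((dvd_add_right (h.mul_right X)).1 hdvd))⟩

/-- Lemma: if `s ∈ M_m` is maximal, then `d_t(s) ≤ ρ(s) ≤ 2·d_{t+1}(s) − 1`. -/
theorem maximal_dt_le_rho_le {F : Type} [Field F] [Fintype F]
    (m : ℕ) (hm : 0 < m) (s : F[X]) (hs : IsMaximal m s) :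
    dt s ≤ rho s ∧ rho s ≤ 2 * dt1 s - 1 := by
  constructor
  · refine csSup_le' ?_
    rintro d ⟨p, hpm, hp, hps, rfl⟩
    exact natDegree_le_rho hs hpm hp hps
  · obtain ⟨p, hpm, hp, hps⟩ := exists_monic_irreducible_not_dvd hs.1
    obtain ⟨-, p, hpm, hp, hdeg, hps⟩ :=
      Nat.sInf_mem (s := {d : ℕ | 0 < d ∧ ∃ p : F[X], p.Monic ∧ Irreducible p ∧
        p.natDegree = d ∧ ¬ p ∣ s}) ⟨_, hp.natDegree_pos, p, hpm, hp, rfl, hps⟩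
    have h := rho_le hs hpm hp hps
    rwa [hdeg] at h
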